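/- arXiv:math/0307138 — 2 statements merged into one kernel-verified Lean document; each statement's English description precedes it below -/
import Mathlib

section
/- If A is a finitely generated commutative k-algebra over an algebraically closed field k, then for all words w and w' of letters one has the set-theoretic equalities O^l_{ww'} = O^l_{w'w} and O^r_{ww'} = O^r_{w'w}. In particular both Λ^l_A and Λ^r_A are commutative topologies: O^•_w ∧ O^•_{w'} ≈ O^•_{w'} ∧ O^•_w for • ∈ {l, r}. -/
/-!
Common setup: Jordan–Hölder filtrations of finite-dimensional modules, letters
(subsets of `simp A`, i.e. sets of simple finite-dimensional modules taken up to
isomorphism), words of letters, and the left/right basic opens of the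
non-commutative topology on `rep A`.
-/

namespace NCT

/-- The `i`-th factor `F (i+1) / F i` of a chain of submodules. -/
def chainFactor {A : Type} [Ring A] {M : Type} [AddCommGroup M] [Module A M]
    {u : ℕ} (F : Fin (u + 1) → Submodule A M) (i : Fin u) : Type :=
  ↥(F i.succ) ⧸ Submodule.comap (F i.succ).subtype (F i.castSucc)

noncomputable instance {A : Type} [Ring A] {M : Type} [AddCommGroup M] [Module A M]
    {u : ℕ} (F : Fin (u + 1) → Submodule A M) (i : Fin u) :
    AddCommGroup (chainFactor F i) :=
  inferInstanceAs (AddCommGroup (↥(F i.succ) ⧸ Submodule.comap (F i.succ).subtype (F i.castSucc)))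

noncomputable instance {A : Type} [Ring A] {M : Type} [AddCommGroup M] [Module A M]
    {u : ℕ} (F : Fin (u + 1) → Submodule A M) (i : Fin u) :
    Module A (chainFactor F i) :=
  inferInstanceAs (Module A (↥(F i.succ) ⧸ Submodule.comap (F i.succ).subtype (F i.castSucc)))

/-- A Jordan–Hölder filtration: `0 = M₀ ⊆ M₁ ⊆ ⋯ ⊆ M_u = M` with all successive
factors simple (simplicity of the factors forces the inclusions to be strict). -/
def IsJHFiltration {A : Type} [Ring A] {M : Type} [AddCommGroup M] [Module A M]
    {u : ℕ} (F : Fin (u + 1) → Submodule A M) : Prop :=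
  Monotone F ∧ F 0 = ⊥ ∧ F (Fin.last u) = ⊤ ∧
    ∀ i : Fin u, IsSimpleModule A (chainFactor F i)

/-- Membership of a module `N` in a letter `V` (letters are sets of modules,
membership is taken up to isomorphism, so a letter is a subset of `simp A`). -/
def MemLetter {A : Type} [Ring A] (V : Set (ModuleCat.{0} A)) (N : Type)
    [AddCommGroup N] [Module A N] : Prop :=
  ∃ P ∈ V, Nonempty (N ≃ₗ[A] P)

/-- `rep A`: the finite-dimensional (over `k`) `A`-modules. -/
def FDRep (k A : Type) [Field k] [Ring A] [Algebra k A] : Set (ModuleCat.{0} A) :=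
  {M | Module.Finite k (RestrictScalars k A M)}

/-- `simp A`: the simple finite-dimensional `A`-modules. -/
def SimpFD (k A : Type) [Field k] [Ring A] [Algebra k A] : Set (ModuleCat.{0} A) :=
  {M | IsSimpleModule A M ∧ Module.Finite k (RestrictScalars k A M)}

/-- A word of letters. -/
abbrev Word (A : Type) [Ring A] := List (Set (ModuleCat.{0} A))

/-- The left basic open `𝒪^l_w`: finite-dimensional modules admitting a Jordan–Hölder
filtration of length `u ≥ |w|` whose first `|w|` factors lie, in order, in the letters of `w`. -/
def leftOpen (k A : Type) [Field k] [Ring A] [Algebra k A] (w : Word A) :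
    Set (ModuleCat.{0} A) :=
  {M | M ∈ FDRep k A ∧ ∃ (u : ℕ) (F : Fin (u + 1) → Submodule A M) (hu : w.length ≤ u),
    IsJHFiltration F ∧
    ∀ i : Fin w.length, MemLetter (w.get i) (chainFactor F (Fin.castLE hu i))}

/-- The right basic open `𝒪^r_w`: finite-dimensional modules admitting a Jordan–Hölder
filtration of length `u ≥ |w|` whose top `|w|` factors match `w` in order. -/
def rightOpen (k A : Type) [Field k] [Ring A] [Algebra k A] (w : Word A) :
    Set (ModuleCat.{0} A) :=
  {M | M ∈ FDRep k A ∧ ∃ (u : ℕ) (F : Fin (u + 1) → Submodule A M) (hu : w.length ≤ u),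
    IsJHFiltration F ∧
    ∀ i : Fin w.length,
      MemLetter (w.get i) (chainFactor F ⟨u - w.length + i.1, by have := i.isLt; omega⟩)}

/-- `rep(m)` for a multiset of letters `m`: modules with a Jordan–Hölder filtration whose
factors can be matched, by distinct indices, to the occurrences of letters in `m`,
each matched factor lying in its letter. -/
def RepMS (k A : Type) [Field k] [Ring A] [Algebra k A]
    (m : Multiset (Set (ModuleCat.{0} A))) : Set (ModuleCat.{0} A) :=
  {M | M ∈ FDRep k A ∧ ∃ (u : ℕ) (F : Fin (u + 1) → Submodule A M),
    IsJHFiltration F ∧ ∃ (l : Word A) (_ : (l : Multiset (Set (ModuleCat.{0} A))) = m)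
      (f : Fin l.length ↪ Fin u), ∀ j : Fin l.length, MemLetter (l.get j) (chainFactor F (f j))}

/-- The multiset `w ∪ w'`: each letter with the maximum of its multiplicities in `w`, `w'`. -/
noncomputable def wordSup {A : Type} [Ring A] (w w' : Word A) :
    Multiset (Set (ModuleCat.{0} A)) :=
  letI := Classical.decEq (Set (ModuleCat.{0} A))
  (w : Multiset (Set (ModuleCat.{0} A))) ∪ (w' : Multiset (Set (ModuleCat.{0} A)))

/-- `𝒪^l_w ≤ 𝒪^l_{w'}`, i.e. `𝒪^l_w(w ∪ w') ⊆ 𝒪^l_{w'}(w ∪ w')`. -/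
def LeL (k A : Type) [Field k] [Ring A] [Algebra k A] (w w' : Word A) : Prop :=
  leftOpen k A w ∩ RepMS k A (wordSup w w') ⊆ leftOpen k A w' ∩ RepMS k A (wordSup w w')

/-- `𝒪^l_w ≈ 𝒪^l_{w'}`, i.e. `𝒪^l_w(w ∪ w') = 𝒪^l_{w'}(w ∪ w')`. -/
def EquivL (k A : Type) [Field k] [Ring A] [Algebra k A] (w w' : Word A) : Prop :=
  leftOpen k A w ∩ RepMS k A (wordSup w w') = leftOpen k A w' ∩ RepMS k A (wordSup w w')

/-- `𝒪^r_w ≤ 𝒪^r_{w'}`. -/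
def LeR (k A : Type) [Field k] [Ring A] [Algebra k A] (w w' : Word A) : Prop :=
  rightOpen k A w ∩ RepMS k A (wordSup w w') ⊆ rightOpen k A w' ∩ RepMS k A (wordSup w w')

/-- `𝒪^r_w ≈ 𝒪^r_{w'}`. -/
def EquivR (k A : Type) [Field k] [Ring A] [Algebra k A] (w w' : Word A) : Prop :=
  rightOpen k A w ∩ RepMS k A (wordSup w w') = rightOpen k A w' ∩ RepMS k A (wordSup w w')

/-- Relative quotient `X / (X ∩ Y)`. -/
abbrev RQ {A : Type} [CommRing A] {M : Type} [AddCommGroup M] [Module A M]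
    (X Y : Submodule A M) : Type := ↥X ⧸ Submodule.comap X.subtype Y

/-- Second isomorphism theorem in the form used below. -/
theorem rq_iso {A : Type} [CommRing A] {M : Type} [AddCommGroup M] [Module A M]
    (X Y P Z : Submodule A M) (hsup : P ⊔ Y = X) (hinf : P ⊓ Y = Z) :
    Nonempty (RQ P Z ≃ₗ[A] RQ X Y) := by
  subst hsup hinf
  exact ⟨LinearMap.quotientInfEquivSupQuotient P Y⟩

/-- Exchange of two adjacent simple factors. -/
theorem exchange {A : Type} [CommRing A] {M : Type} [AddCommGroup M] [Module A M]
    (X Y Z : Submodule A M) (hZY : Z ≤ Y) (hYX : Y ≤ X)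
    (h1 : IsSimpleModule A (RQ X Y)) (h2 : IsSimpleModule A (RQ Y Z)) :
    ∃ P : Submodule A M, Z ≤ P ∧ P ≤ X ∧ Nonempty (RQ P Z ≃ₗ[A] RQ X Y) ∧
      Nonempty (RQ X P ≃ₗ[A] RQ Y Z) := by
  obtain ⟨n, hn, ⟨e1⟩⟩ := isSimpleModule_iff_quot_maximal.mp h1
  obtain ⟨m, hm, ⟨e2⟩⟩ := isSimpleModule_iff_quot_maximal.mp h2
  by_cases hmn : m = n
  · subst hmn
    exact ⟨Y, hZY, hYX, ⟨e2.trans e1.symm⟩, ⟨e1.trans e2.symm⟩⟩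
  have hcop := Ideal.isCoprime_iff_exists.mp
    (Ideal.isCoprime_iff_sup_eq.mpr (Ideal.IsMaximal.coprime_of_ne hm hn hmn))
  obtain ⟨a, ha, b, hb, hab⟩ := hcop
  have kill : ∀ (X Y : Submodule A M) (n : Ideal A) (_ : RQ X Y ≃ₗ[A] A ⧸ n) (b : A),
      b ∈ n → ∀ x ∈ X, b • x ∈ Y := by
    intro X Y n e b hb x hx
    have h0 : (Submodule.comap X.subtype Y).mkQ (b • ⟨x, hx⟩) = 0 := by
      apply e.injective
      rw [map_smul, map_smul, map_zero]
      generalize e _ = q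
      obtain ⟨q, rfl⟩ := Ideal.Quotient.mk_surjective q
      rw [Algebra.smul_def, Ideal.Quotient.algebraMap_eq, Ideal.Quotient.eq_zero_iff_mem.mpr hb,
        zero_mul]
    simpa using h0
  have hbX := kill X Y n e1 b hb
  have haY := kill Y Z m e2 a ha
  have hsplit : ∀ x : M, x = a • x + b • x := fun x => by rw [← add_smul, hab, one_smul]
  set P : Submodule A M := Z ⊔ X.map (LinearMap.lsmul A M a) with hP
  have hPX : P ≤ X := by
    refine sup_le (hZY.trans hYX) ?_
    rintro _ ⟨x, hx, rfl⟩
    exact X.smul_mem a hx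
  have hsup : P ⊔ Y = X := by
    refine le_antisymm (sup_le hPX hYX) fun x hx => ?_
    rw [hsplit x]
    exact add_mem (Submodule.mem_sup_left (Submodule.mem_sup_right ⟨x, hx, rfl⟩))
      (Submodule.mem_sup_right (hbX x hx))
  have hinf : P ⊓ Y = Z := by
    refine le_antisymm ?_ (le_inf le_sup_left hZY)
    rintro y ⟨hyP, hyY⟩
    obtain ⟨z, hz, t, ⟨x, hx, rfl⟩, rfl⟩ := Submodule.mem_sup.mp hyP
    rw [hsplit (z + _)]
    refine add_mem (haY _ hyY) ?_
    rw [smul_add]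
    refine add_mem (Z.smul_mem b hz) ?_
    have := haY _ (hbX x hx)
    rw [smul_comm] at this
    exact this
  refine ⟨P, le_sup_left, hPX, rq_iso X Y P Z hsup hinf, ?_⟩
  obtain ⟨e⟩ := rq_iso X P Y Z (by rw [sup_comm, hsup]) (by rw [inf_comm, hinf])
  exact ⟨e.symm⟩

theorem swap_adj {A : Type} [CommRing A] {M : Type} [AddCommGroup M] [Module A M]
    {n : ℕ} (F : Fin (n + 2) → Submodule A M) (hF : IsJHFiltration F) (i : Fin n) :
    ∃ F' : Fin (n + 2) → Submodule A M, IsJHFiltration F' ∧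
      ∀ j, Nonempty (chainFactor F' j ≃ₗ[A]
        chainFactor F (Equiv.swap i.castSucc i.succ j)) := by
  obtain ⟨hmono, h0, hl, hs⟩ := hF
  obtain ⟨P, hZP, hPX, ⟨e1⟩, ⟨e2⟩⟩ := exchange (F i.succ.succ) (F i.succ.castSucc)
    (F i.castSucc.castSucc) (hmono (by simp [Fin.le_def])) (hmono (by simp [Fin.le_def]))
    (hs i.succ) (hs i.castSucc)
  have hiso : ∀ j, Nonempty (chainFactor (Function.update F i.succ.castSucc P) j ≃ₗ[A]
        chainFactor F (Equiv.swap i.castSucc i.succ j)) := by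
    intro j
    change Nonempty (RQ (Function.update F i.succ.castSucc P j.succ)
      (Function.update F i.succ.castSucc P j.castSucc) ≃ₗ[A] _)
    by_cases hj1 : j = i.castSucc
    · subst hj1
      rw [Equiv.swap_apply_left, Fin.succ_castSucc, Function.update_self,
        Function.update_of_ne (by simp [Fin.ext_iff])]
      exact ⟨e1⟩
    by_cases hj2 : j = i.succ
    · subst hj2
      rw [Equiv.swap_apply_right, Function.update_self,
        Function.update_of_ne (by simp [Fin.ext_iff])]
      exact ⟨e2⟩
    rw [Equiv.swap_apply_of_ne_of_ne hj1 hj2,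
      Function.update_of_ne (by simpa [Fin.ext_iff] using hj1),
      Function.update_of_ne (by simpa [Fin.ext_iff] using hj2)]
    exact ⟨LinearEquiv.refl A _⟩
  refine ⟨Function.update F i.succ.castSucc P, ⟨?_, ?_, ?_, ?_⟩, hiso⟩
  · rw [Fin.monotone_iff_le_succ]
    intro j
    by_cases hj1 : j = i.castSucc
    · subst hj1
      rw [Fin.succ_castSucc, Function.update_self,
        Function.update_of_ne (by simp [Fin.ext_iff])]
      exact hZP
    by_cases hj2 : j = i.succ
    · subst hj2
      rw [Function.update_self, Function.update_of_ne (by simp [Fin.ext_iff])]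
      exact hPX
    rw [Function.update_of_ne (by simpa [Fin.ext_iff] using hj2),
      Function.update_of_ne (by simpa [Fin.ext_iff] using hj1)]
    exact hmono (by simp [Fin.le_def])
  · rw [Function.update_of_ne (by simp [Fin.ext_iff]), h0]
  · rw [Function.update_of_ne (by have := i.isLt; simp [Fin.ext_iff]; omega), hl]
  · intro j
    obtain ⟨e⟩ := hiso j
    have := hs (Equiv.swap i.castSucc i.succ j)
    exact IsSimpleModule.congr e

theorem permute {A : Type} [CommRing A] {M : Type} [AddCommGroup M] [Module A M]
    {u : ℕ} (F : Fin (u + 1) → Submodule A M) (hF : IsJHFiltration F)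
    (σ : Equiv.Perm (Fin u)) :
    ∃ F' : Fin (u + 1) → Submodule A M, IsJHFiltration F' ∧
      ∀ j, Nonempty (chainFactor F' j ≃ₗ[A] chainFactor F (σ j)) := by
  cases u with
  | zero => exact ⟨F, hF, fun j => j.elim0⟩
  | succ n =>
    have hσ : σ ∈ Submonoid.closure
        (Set.range fun i : Fin n => Equiv.swap i.castSucc i.succ) := by
      rw [Equiv.Perm.mclosure_swap_castSucc_succ]; trivial
    induction hσ using Submonoid.closure_induction generalizing F with
    | mem x hx =>
      obtain ⟨i, rfl⟩ := hx
      exact swap_adj F hF i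
    | one => exact ⟨F, hF, fun j => ⟨LinearEquiv.refl A _⟩⟩
    | mul x y _ _ hx hy =>
      obtain ⟨F1, hF1, h1⟩ := hx F hF
      obtain ⟨F2, hF2, h2⟩ := hy F1 hF1
      refine ⟨F2, hF2, fun j => ?_⟩
      obtain ⟨e1⟩ := h1 (y j)
      obtain ⟨e2⟩ := h2 j
      exact ⟨e2.trans e1⟩

theorem extend_inj {α β : Type} [Finite β] (f g : α → β)
    (hf : Function.Injective f) (hg : Function.Injective g) :
    ∃ σ : Equiv.Perm β, ∀ x, σ (f x) = g x := by
  classical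
  have := Fintype.ofFinite β
  let e : {x // x ∈ Set.range f} ≃ {x // x ∈ Set.range g} :=
    (Equiv.ofInjective f hf).symm.trans (Equiv.ofInjective g hg)
  refine ⟨e.extendSubtype, fun x => ?_⟩
  rw [Equiv.extendSubtype_apply_of_mem e (f x) ⟨x, rfl⟩]
  have : (⟨f x, ⟨x, rfl⟩⟩ : {x // x ∈ Set.range f}) = Equiv.ofInjective f hf x := rfl
  rw [this, Equiv.trans_apply, Equiv.symm_apply_apply, Equiv.ofInjective_apply]

/-- The index exchange between `w' ++ w` and `w ++ w'`. -/
theorem index_swap {α : Type*} (w w' : List α) :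
    ∃ g : Fin (w' ++ w).length → Fin (w ++ w').length, Function.Injective g ∧
      ∀ i, (w ++ w').get (g i) = (w' ++ w).get i := by
  refine ⟨fun i => if h : i.1 < w'.length then ⟨w.length + i.1, by simp; omega⟩ else
    ⟨i.1 - w'.length, by have := i.2; simp at this ⊢; omega⟩, ?_, ?_⟩
  · intro i j hij
    have hi := i.2
    have hj := j.2
    simp only [List.length_append] at hi hj
    ext
    dsimp only at hij
    split_ifs at hij <;> simp only [Fin.mk.injEq] at hij <;> omega
  · intro i
    have hi := i.2
    simp only [List.length_append] at hi
    dsimp only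
    split_ifs with h
    · simp [List.getElem_append, h]
    · have : i.1 - w'.length < w.length := by omega
      simp [List.getElem_append, h, this]

theorem memLetter_congr {A : Type} [CommRing A] (V : Set (ModuleCat.{0} A)) (N N' : Type)
    [AddCommGroup N] [Module A N] [AddCommGroup N'] [Module A N'] (e : N ≃ₗ[A] N')
    (h : MemLetter V N') : MemLetter V N := by
  obtain ⟨P, hP, ⟨e'⟩⟩ := h
  exact ⟨P, hP, ⟨e.trans e'⟩⟩

theorem rearrange {A : Type} [CommRing A] {M : Type} [AddCommGroup M] [Module A M]
    (w w' : Word A) {u : ℕ} (F : Fin (u + 1) → Submodule A M) (hF : IsJHFiltration F)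
    (p : Fin (w ++ w').length → Fin u) (hp : Function.Injective p)
    (q : Fin (w' ++ w).length → Fin u) (hq : Function.Injective q)
    (h : ∀ i, MemLetter ((w ++ w').get i) (chainFactor F (p i))) :
    ∃ F' : Fin (u + 1) → Submodule A M, IsJHFiltration F' ∧
      ∀ i, MemLetter ((w' ++ w).get i) (chainFactor F' (q i)) := by
  obtain ⟨g, hg, hgw⟩ := index_swap w w'
  obtain ⟨σ, hσ⟩ := extend_inj q (p ∘ g) hq (hp.comp hg)
  obtain ⟨F', hF', hiso⟩ := permute F hF σ
  refine ⟨F', hF', fun i => ?_⟩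
  obtain ⟨e⟩ := hiso (q i)
  rw [← hgw i]
  refine memLetter_congr _ _ _ e ?_
  rw [hσ]
  exact h (g i)

theorem left_sub (k A : Type) [Field k] [CommRing A] [Algebra k A] (w w' : Word A) :
    leftOpen k A (w ++ w') ⊆ leftOpen k A (w' ++ w) := by
  rintro M ⟨hM, u, F, hu, hF, h⟩
  have hu' : (w' ++ w).length ≤ u := by simp at hu ⊢; omega
  obtain ⟨F', hF', h'⟩ := rearrange w w' F hF (Fin.castLE hu) (Fin.castLE_injective hu)
    (Fin.castLE hu') (Fin.castLE_injective hu') h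
  exact ⟨hM, u, F', hu', hF', h'⟩

theorem right_sub (k A : Type) [Field k] [CommRing A] [Algebra k A] (w w' : Word A) :
    rightOpen k A (w ++ w') ⊆ rightOpen k A (w' ++ w) := by
  rintro M ⟨hM, u, F, hu, hF, h⟩
  have hu' : (w' ++ w).length ≤ u := by simp at hu ⊢; omega
  obtain ⟨F', hF', h'⟩ := rearrange w w' F hF _
    (by intro i j hij; simp only [Fin.mk.injEq] at hij; ext; omega)
    (fun i => ⟨u - (w' ++ w).length + i.1, by have := i.isLt; omega⟩)
    (by intro i j hij; simp only [Fin.mk.injEq] at hij; ext; omega) h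
  exact ⟨hM, u, F', hu', hF', h'⟩

/-- If `A` is a finitely generated commutative `k`-algebra over an
algebraically closed field, then `𝒪^l_{ww'} = 𝒪^l_{w'w}` and `𝒪^r_{ww'} = 𝒪^r_{w'w}`
set-theoretically; in particular `Λ^l_A` and `Λ^r_A` are commutative topologies:
`𝒪^•_w ∧ 𝒪^•_{w'} ≈ 𝒪^•_{w'} ∧ 𝒪^•_w` for `• ∈ {l, r}`. -/
theorem commutative_topology (k A : Type) [Field k] [IsAlgClosed k]
    [CommRing A] [Algebra k A] [Algebra.FiniteType k A]
    (w w' : Word A) (hw : ∀ V ∈ w, V ⊆ SimpFD k A) (hw' : ∀ V ∈ w', V ⊆ SimpFD k A) :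
    leftOpen k A (w ++ w') = leftOpen k A (w' ++ w) ∧
    rightOpen k A (w ++ w') = rightOpen k A (w' ++ w) ∧
    EquivL k A (w ++ w') (w' ++ w) ∧
    EquivR k A (w ++ w') (w' ++ w) := by
  have hl : leftOpen k A (w ++ w') = leftOpen k A (w' ++ w) :=
    Set.Subset.antisymm (left_sub k A w w') (left_sub k A w' w)
  have hr : rightOpen k A (w ++ w') = rightOpen k A (w' ++ w) :=
    Set.Subset.antisymm (right_sub k A w w') (right_sub k A w' w)
  refine ⟨hl, hr, ?_, ?_⟩
  · unfold EquivL
    rw [hl]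
  · unfold EquivR
    rw [hr]

end NCT
end

section
/- If A is a finitely generated commutative k-algebra over an algebraically closed field k, then every left basic open is ∧-idempotent: for every word w, O^l_w ∧ O^l_w ≈ O^l_w, i.e. O^l_{ww} ∩ rep(ww ∪ w) = O^l_w ∩ rep(ww ∪ w). Explicitly: every M ∈ O^l_w admitting a Jordan–Hölder filtration whose factor multiset contains two disjoint matchings of the word w lies in O^l_{ww}. -/
/-!
Common setup: Jordan–Hölder filtrations of finite-dimensional modules, letters
(subsets of `simp A`, i.e. sets of simple finite-dimensional modules taken up to
isomorphism), words of letters, and the left/right basic opens of the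
non-commutative topology on `rep A`.
-/

namespace NCT

/-- One step of a filtration with factor `A / m`, for a maximal ideal `m`. -/
def Step {A : Type} [CommRing A] {M : Type} [AddCommGroup M] [Module A M]
    (P Q : Submodule A M) (m : Ideal A) : Prop :=
  P ⋖ Q ∧ m.IsMaximal ∧ ∀ a ∈ m, ∀ x ∈ Q, a • x ∈ P

/-- A chain of steps from `P` to `Q` with prescribed maximal ideals. -/
def Path {A : Type} [CommRing A] {M : Type} [AddCommGroup M] [Module A M] :
    List (Ideal A) → Submodule A M → Submodule A M → Prop
  | [], P, Q => P = Q
  | m :: L, P, Q => ∃ P', Step P P' m ∧ Path L P' Q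

theorem Step.swap {A : Type} [CommRing A] {M : Type} [AddCommGroup M] [Module A M]
    {P Q R : Submodule A M} {m n : Ideal A} (h₁ : Step P Q m) (h₂ : Step Q R n) :
    ∃ Q', Step P Q' n ∧ Step Q' R m := by
  obtain ⟨c₁, hm, s₁⟩ := h₁
  obtain ⟨c₂, hn, s₂⟩ := h₂
  by_cases hmn : m = n
  · subst hmn
    exact ⟨Q, ⟨c₁, hm, s₁⟩, ⟨c₂, hm, s₂⟩⟩
  have hco : m ⊔ n = ⊤ := Ideal.IsMaximal.coprime_of_ne hm hn hmn
  obtain ⟨a, ha, b, hb, hab⟩ := Submodule.mem_sup.1 ((Ideal.eq_top_iff_one _).1 hco)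
  have hQ' : ∀ c ∈ n, ∀ x ∈ P ⊔ m • R, c • x ∈ P := by
    intro c hc x hx
    have hle : P ⊔ m • R ≤ Submodule.comap (LinearMap.lsmul A M c) P := by
      refine sup_le (fun y hy => P.smul_mem c hy) ?_
      refine Submodule.smul_le.2 (fun r hr y hy => ?_)
      change c • r • y ∈ P
      rw [smul_comm]
      exact s₁ r hr _ (s₂ c hc y hy)
    exact hle hx
  have hinf : Q ⊓ (P ⊔ m • R) = P := by
    apply le_antisymm
    · rintro x ⟨hx1, hx2⟩
      have : x = a • x + b • x := by rw [← add_smul, hab, one_smul]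
      rw [this]
      exact P.add_mem (s₁ a ha x hx1) (hQ' b hb x hx2)
    · exact le_inf c₁.le le_sup_left
  have hsup : Q ⊔ (P ⊔ m • R) = R := by
    apply le_antisymm
    · exact sup_le c₂.le (sup_le (c₁.le.trans c₂.le) Submodule.smul_le_right)
    · intro x hx
      have : x = a • x + b • x := by rw [← add_smul, hab, one_smul]
      rw [this]
      refine Submodule.add_mem _ ?_ ?_
      · exact Submodule.mem_sup_right (Submodule.mem_sup_right (Submodule.smul_mem_smul ha hx))
      · exact Submodule.mem_sup_left (s₂ b hb x hx)
  refine ⟨P ⊔ m • R, ⟨?_, hn, hQ'⟩, ⟨?_, hm, ?_⟩⟩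
  · have : Q ⋖ Q ⊔ (P ⊔ m • R) := by rwa [hsup]
    have h := inf_covBy_of_covBy_sup_left this
    rwa [hinf] at h
  · have : Q ⊓ (P ⊔ m • R) ⋖ Q := by rwa [hinf]
    have h := covBy_sup_of_inf_covBy_left this
    rwa [hsup] at h
  · intro r hr x hx
    exact Submodule.mem_sup_right (Submodule.smul_mem_smul hr hx)

theorem Path.perm {A : Type} [CommRing A] {M : Type} [AddCommGroup M] [Module A M]
    {L L' : List (Ideal A)} (h : L.Perm L') :
    ∀ {P Q : Submodule A M}, Path L P Q → Path L' P Q := by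
  induction h with
  | nil => exact fun h => h
  | cons x _ ih =>
    rintro P Q ⟨P', h1, h2⟩
    exact ⟨P', h1, ih h2⟩
  | swap x y l =>
    rintro P Q ⟨P', h1, P'', h2, h3⟩
    obtain ⟨Q', h4, h5⟩ := h1.swap h2
    exact ⟨Q', h4, P'', h5, h3⟩
  | trans _ _ ih1 ih2 => exact fun h => ih2 (ih1 h)

theorem Path.ofChain {A : Type} [CommRing A] {M : Type} [AddCommGroup M] [Module A M] :
    ∀ {u : ℕ} (F : Fin (u + 1) → Submodule A M) (m : Fin u → Ideal A),
      (∀ i, Step (F i.castSucc) (F i.succ) (m i)) →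
      Path (List.ofFn m) (F 0) (F (Fin.last u)) := by
  intro u
  induction u with
  | zero => intro F m _; simp [Path]
  | succ u ih =>
    intro F m h
    rw [List.ofFn_succ]
    refine ⟨F 1, h 0, ?_⟩
    exact ih (fun i => F i.succ) (fun i => m i.succ) (fun i => h i.succ)

theorem Path.toChain {A : Type} [CommRing A] {M : Type} [AddCommGroup M] [Module A M] :
    ∀ (L : List (Ideal A)) (P Q : Submodule A M), Path L P Q →
      ∃ F : Fin (L.length + 1) → Submodule A M, F 0 = P ∧ F (Fin.last _) = Q ∧
        ∀ i : Fin L.length, Step (F i.castSucc) (F i.succ) (L.get i) := by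
  intro L
  induction L with
  | nil => intro P Q h; exact ⟨fun _ => P, rfl, h, fun i => i.elim0⟩
  | cons m L ih =>
    rintro P Q ⟨P', h1, h2⟩
    obtain ⟨F, hF0, hFl, hF⟩ := ih P' Q h2
    refine ⟨Fin.cons (α := fun _ => Submodule A M) P F, rfl, hFl, ?_⟩
    intro i
    refine Fin.cases ?_ (fun j => ?_) i
    · change Step P (F 0) m
      rwa [hF0]
    · exact hF j

theorem exists_step {A : Type} [CommRing A] {M : Type} [AddCommGroup M] [Module A M]
    {u : ℕ} {F : Fin (u + 1) → Submodule A M} (hF : IsJHFiltration F) (i : Fin u) :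
    ∃ m : Ideal A, Step (F i.castSucc) (F i.succ) m := by
  obtain ⟨hmono, -, -, hs⟩ := hF
  have hle : F i.castSucc ≤ F i.succ := hmono (Fin.castSucc_le_succ i)
  have hsi : IsSimpleModule A
    (↥(F i.succ) ⧸ Submodule.comap (F i.succ).subtype (F i.castSucc)) := hs i
  obtain ⟨m, hm, ⟨e⟩⟩ := isSimpleModule_iff_quot_maximal.1 hsi
  refine ⟨m, (covBy_iff_quot_is_simple hle).2 hsi, hm, fun a ha x hx => ?_⟩
  have h0 : a • (Submodule.Quotient.mk ⟨x, hx⟩ :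
      ↥(F i.succ) ⧸ Submodule.comap (F i.succ).subtype (F i.castSucc)) = 0 := by
    apply e.injective
    rw [map_smul, map_zero]
    have : a ∈ Module.annihilator A (A ⧸ m) := by rwa [Ideal.annihilator_quotient]
    exact Module.mem_annihilator.1 this _
  rw [← Submodule.Quotient.mk_smul, Submodule.Quotient.mk_eq_zero] at h0
  exact h0

theorem Step.factor {A : Type} [CommRing A] {M : Type} [AddCommGroup M] [Module A M]
    {u : ℕ} {F : Fin (u + 1) → Submodule A M} {i : Fin u} {m : Ideal A}
    (h : Step (F i.castSucc) (F i.succ) m) :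
    IsSimpleModule A (chainFactor F i) ∧ Nonempty (chainFactor F i ≃ₗ[A] (A ⧸ m)) := by
  obtain ⟨c, hm, hs⟩ := h
  have hsi : IsSimpleModule A
    (↥(F i.succ) ⧸ Submodule.comap (F i.succ).subtype (F i.castSucc)) :=
    (covBy_iff_quot_is_simple c.le).1 c
  refine ⟨hsi, ?_⟩
  obtain ⟨n, hn, ⟨e⟩⟩ := isSimpleModule_iff_quot_maximal.1 hsi
  have hmn : m ≤ n := by
    intro a ha
    rw [← Ideal.annihilator_quotient (I := n), ← e.annihilator_eq, Module.mem_annihilator]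
    intro q
    obtain ⟨x, rfl⟩ := Submodule.Quotient.mk_surjective _ q
    rw [← Submodule.Quotient.mk_smul, Submodule.Quotient.mk_eq_zero]
    exact hs a ha x.1 x.2
  obtain rfl := hm.eq_of_le hn.ne_top hmn
  exact ⟨e⟩

theorem MemLetter.congr {A : Type} [CommRing A] {V : Set (ModuleCat.{0} A)} {N N' : Type}
    [AddCommGroup N] [Module A N] [AddCommGroup N'] [Module A N'] (e : N ≃ₗ[A] N')
    (h : MemLetter V N) : MemLetter V N' := by
  obtain ⟨P, hP, ⟨f⟩⟩ := h
  exact ⟨P, hP, ⟨e.symm.trans f⟩⟩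

theorem ofFn_comp_perm {α : Type} {n u : ℕ} (m : Fin u → α) (f : Fin n ↪ Fin u) :
    ∃ r : List α, (List.ofFn (m ∘ f) ++ r).Perm (List.ofFn m) := by
  have h1 : (List.ofFn f).Subperm (List.finRange u) :=
    List.subperm_of_subset (List.nodup_ofFn.2 f.injective) (fun x _ => List.mem_finRange x)
  obtain ⟨s, hp, hs⟩ := h1
  obtain ⟨r, hr⟩ := hs.exists_perm_append
  refine ⟨r.map m, ?_⟩
  rw [← List.map_ofFn, List.ofFn_eq_map (f := m), ← List.map_append]
  exact (hr.trans (hp.append_right r)).symm.map m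

theorem wordSup_append_self {A : Type} [Ring A] (w : Word A) :
    wordSup (w ++ w) w = ((w ++ w : Word A) : Multiset (Set (ModuleCat.{0} A))) := by
  classical
  unfold wordSup
  refine le_antisymm (Multiset.union_le le_rfl ?_) Multiset.le_union_left
  rw [← Multiset.coe_add]
  exact Multiset.le_add_right _ _

theorem repMS_subset_leftOpen (k A : Type) [Field k] [CommRing A] [Algebra k A] (w : Word A) :
    RepMS k A (w : Multiset (Set (ModuleCat.{0} A))) ⊆ leftOpen k A w := by
  rintro M ⟨hM, u, F, hF, l, hl, f, hf⟩
  refine ⟨hM, ?_⟩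
  choose m hm using exists_step hF
  have hpath := Path.ofChain F m hm
  rw [hF.2.1, hF.2.2.1] at hpath
  have h1 : List.Forall₂ (fun V (I : Ideal A) => MemLetter V (A ⧸ I)) l
      (List.ofFn (m ∘ f)) := by
    rw [List.forall₂_iff_get]
    refine ⟨by simp, fun i hi hi' => ?_⟩
    obtain ⟨e⟩ := (hm (f ⟨i, hi⟩)).factor.2
    have := (hf ⟨i, hi⟩).congr e
    have e2 : (List.ofFn (m ∘ f)).get ⟨i, hi'⟩ = m (f ⟨i, hi⟩) := by simp
    rw [e2]
    exact this
  obtain ⟨L, hL1, hL2⟩ : ∃ L, List.Forall₂ (fun V (I : Ideal A) => MemLetter V (A ⧸ I)) w L ∧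
      L.Perm (List.ofFn (m ∘ f)) := by
    have hp : w.Perm l := (Multiset.coe_eq_coe.1 hl).symm
    have h2 := List.perm_comp_forall₂ hp h1
    obtain ⟨L, a, b⟩ := h2
    exact ⟨L, a, b⟩
  obtain ⟨r, hr⟩ := ofFn_comp_perm m f
  have hpath2 := hpath.perm ((hL2.append_right r).trans hr).symm
  obtain ⟨G, hG0, hGl, hG⟩ := Path.toChain _ _ _ hpath2
  have hlen := hL1.length_eq
  refine ⟨_, G, by rw [List.length_append]; omega, ⟨?_, hG0, hGl, fun i => (hG i).factor.1⟩, ?_⟩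
  · exact Fin.monotone_iff_le_succ.2 (fun i => (hG i).1.le)
  · intro i
    obtain ⟨e⟩ := (hG (Fin.castLE (by rw [List.length_append]; omega) i)).factor.2
    refine MemLetter.congr e.symm ?_
    have hi : i.1 < L.length := by have := i.2; omega
    have := hL1.get i.2 hi
    have e2 : (L ++ r).get (Fin.castLE (by rw [List.length_append]; omega) i)
        = L.get ⟨i.1, hi⟩ := by simp [List.getElem_append_left hi]
    rw [e2]
    exact this

theorem leftOpen_append_subset (k A : Type) [Field k] [CommRing A] [Algebra k A] (w v : Word A) :
    leftOpen k A (w ++ v) ⊆ leftOpen k A w := by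
  rintro M ⟨hM, u, F, hu, hF, h⟩
  have hlen : w.length ≤ (w ++ v).length := by simp
  refine ⟨hM, u, F, hlen.trans hu, hF, fun i => ?_⟩
  have := h (Fin.castLE hlen i)
  have e2 : (w ++ v).get (Fin.castLE hlen i) = w.get i := by
    simp [List.getElem_append_left i.2]
  rw [e2] at this
  exact this

/-- If `A` is a finitely generated commutative `k`-algebra over an
algebraically closed field, every left basic open is `∧`-idempotent:
`𝒪^l_w ∧ 𝒪^l_w ≈ 𝒪^l_w`, i.e. `𝒪^l_{ww} ∩ rep(ww ∪ w) = 𝒪^l_w ∩ rep(ww ∪ w)`. -/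
theorem leftOpen_idempotent (k A : Type) [Field k] [IsAlgClosed k]
    [CommRing A] [Algebra k A] [Algebra.FiniteType k A]
    (w : Word A) (hw : ∀ V ∈ w, V ⊆ SimpFD k A) :
    leftOpen k A (w ++ w) ∩ RepMS k A (wordSup (w ++ w) w)
      = leftOpen k A w ∩ RepMS k A (wordSup (w ++ w) w) := by
  apply Set.Subset.antisymm
  · rintro M ⟨h1, h2⟩
    exact ⟨leftOpen_append_subset k A w w h1, h2⟩
  · rintro M ⟨_, h2⟩
    refine ⟨?_, h2⟩
    rw [wordSup_append_self] at h2
    exact repMS_subset_leftOpen k A _ h2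

end NCT
end
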